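/- Let X₀ be a real random variable with distribution ν having finite first moment (∫|x₀| dν(x₀) < ∞), let a ≠ 0 and σ > 0, and let φ_σ(u) = (2πσ²)^{−1/2}·exp(−u²/(2σ²)) be the N(0,σ²) density. Define p(x) := ∫ φ_σ(x − a·x₀) dν(x₀), the density of X = a·X₀ + σ·Z for Z standard normal independent of X₀, and define the posterior mean m(x) := (∫ x₀ · φ_σ(x − a·x₀) dν(x₀)) / p(x). Then p is strictly positive and differentiable on ℝ, and Tweedie's formula holds: for every x ∈ ℝ, m(x) = (x + σ² · (p'(x)/p(x))) / a, i.e. E[X₀ | X = x] = (1/a)·(x + σ²·(d/dx) log p(x)). -/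

import Mathlib

open MeasureTheory

/-- If `φ` is a bounded solution of `σ² φ'(u) = -u φ(u)`, then
`x ↦ ∫ φ (x - a y) dν(y)` can be differentiated under the integral sign. -/
theorem hasDerivAt_integral_comp_sub_mul
    {ν : Measure ℝ} [IsFiniteMeasure ν] (hν : Integrable (fun y : ℝ => |y|) ν)
    {φ : ℝ → ℝ} {C σ : ℝ} (a : ℝ) (hbound : ∀ u, |φ u| ≤ C)
    (hderiv : ∀ u, HasDerivAt φ (-(u / σ ^ 2) * φ u) u) (x : ℝ) :
    HasDerivAt (fun x => ∫ y, φ (x - a * y) ∂ν)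
      (∫ y, -((x - a * y) / σ ^ 2) * φ (x - a * y) ∂ν) x := by
  have hφ : Continuous φ := continuous_iff_continuousAt.2 fun u => (hderiv u).continuousAt
  refine (hasDerivAt_integral_of_dominated_loc_of_deriv_le
    (bound := fun y => (|x| + 1 + |a| * |y|) / σ ^ 2 * C)
    (F := fun x y => φ (x - a * y))
    (F' := fun x y => -((x - a * y) / σ ^ 2) * φ (x - a * y))
    (Metric.ball_mem_nhds x one_pos) ?_ ?_ ?_ ?_ ?_ ?_).2
  · exact .of_forall fun z => (by fun_prop : Continuous _).aestronglyMeasurable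
  · exact .of_bound (by fun_prop : Continuous _).aestronglyMeasurable C
      (.of_forall fun y => hbound _)
  · exact (by fun_prop : Continuous _).aestronglyMeasurable
  · refine .of_forall fun y z hz => ?_
    have hz : |z| ≤ |x| + 1 := by
      have h := abs_sub_abs_le_abs_sub z x
      rw [Metric.mem_ball, Real.dist_eq] at hz
      linarith
    have hu : |z - a * y| ≤ |x| + 1 + |a| * |y| := by
      have h := abs_sub z (a * y)
      rw [abs_mul] at h
      linarith
    rw [Real.norm_eq_abs, abs_mul, abs_neg, abs_div, abs_of_nonneg (sq_nonneg σ)]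
    gcongr
    exact hbound _
  · exact ((((integrable_const _).add (hν.const_mul _)).div_const _).mul_const _)
  · refine .of_forall fun y z _ => ?_
    simpa using (hderiv (z - a * y)).comp_sub_const z (a * y)

theorem hasDerivAt_const_mul_exp_neg_sq_div (c σ u : ℝ) (hσ : σ ≠ 0) :
    HasDerivAt (fun u => c * Real.exp (-u ^ 2 / (2 * σ ^ 2)))
      (-(u / σ ^ 2) * (c * Real.exp (-u ^ 2 / (2 * σ ^ 2)))) u := by
  refine ((((hasDerivAt_pow 2 u).fun_neg.div_const (2 * σ ^ 2)).exp.const_mul c)).congr_deriv ?_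
  simp only [Nat.cast_ofNat, Nat.add_one_sub_one, pow_one]
  field_simp

/-- One-dimensional Tweedie's formula (the paper's Eq. 4): for `X = a·X₀ + σ·Z`
with `X₀ ∼ ν` of finite first moment and `Z` standard normal independent of
`X₀`, the marginal density `p(x) = ∫ φ_σ(x − a·x₀) dν(x₀)` is strictly positive
and differentiable, and the posterior mean
`m(x) = (∫ x₀ φ_σ(x − a·x₀) dν(x₀))/p(x)` satisfies
`m(x) = (x + σ²·p'(x)/p(x))/a`. -/
theorem tweedie_formula_one_dim
    (ν : Measure ℝ) [IsProbabilityMeasure ν]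
    (hmom : Integrable (fun x₀ : ℝ => |x₀|) ν)
    (a : ℝ) (ha : a ≠ 0) (σ : ℝ) (hσ : 0 < σ)
    (φ : ℝ → ℝ)
    (hφ : φ = fun u => (2 * Real.pi * σ ^ 2) ^ (-(1 : ℝ) / 2)
        * Real.exp (-u ^ 2 / (2 * σ ^ 2)))
    (p : ℝ → ℝ) (hp : p = fun x => ∫ x₀, φ (x - a * x₀) ∂ν)
    (m : ℝ → ℝ) (hm : m = fun x => (∫ x₀, x₀ * φ (x - a * x₀) ∂ν) / p x) :
    (∀ x, 0 < p x) ∧ Differentiable ℝ p ∧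
    ∀ x, m x = (x + σ ^ 2 * (deriv p x / p x)) / a := by
  set c : ℝ := (2 * Real.pi * σ ^ 2) ^ (-(1 : ℝ) / 2)
  have hc_pos : 0 < c := by positivity
  have hφ_pos : ∀ u, 0 < φ u := fun u => by rw [hφ]; positivity
  have hφ_le : ∀ u, |φ u| ≤ c := fun u => by
    rw [abs_of_pos (hφ_pos u), hφ]
    refine mul_le_of_le_one_right hc_pos.le (Real.exp_le_one_iff.2 ?_)
    exact div_nonpos_of_nonpos_of_nonneg (neg_nonpos.2 (sq_nonneg u)) (by positivity)
  have hφ_deriv : ∀ u, HasDerivAt φ (-(u / σ ^ 2) * φ u) u := fun u => by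
    rw [hφ]
    exact hasDerivAt_const_mul_exp_neg_sq_div c σ u hσ.ne'
  have hφ_cont : Continuous φ :=
    continuous_iff_continuousAt.2 fun u => (hφ_deriv u).continuousAt
  have hφ_int : ∀ x, Integrable (fun y => φ (x - a * y)) ν := fun x =>
    .of_bound (by fun_prop : Continuous _).aestronglyMeasurable c (.of_forall fun y => hφ_le _)
  have hmul_int : ∀ x, Integrable (fun y => y * φ (x - a * y)) ν := fun x => by
    refine (hmom.mul_const c).mono' (by fun_prop : Continuous _).aestronglyMeasurable
      (.of_forall fun y => ?_)
    rw [Real.norm_eq_abs, abs_mul]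
    gcongr
    exact hφ_le _
  have hp_pos : ∀ x, 0 < p x := fun x => by
    rw [hp]
    refine (integral_pos_iff_support_of_nonneg (fun y => (hφ_pos _).le) (hφ_int x)).2 ?_
    have hsupp : Function.support (fun y => φ (x - a * y)) = Set.univ :=
      Set.eq_univ_of_forall fun y => (hφ_pos _).ne'
    simp [hsupp]
  have hp_deriv : ∀ x, HasDerivAt p
      (-(x / σ ^ 2) * p x + a / σ ^ 2 * ∫ y, y * φ (x - a * y) ∂ν) x := fun x => by
    convert hasDerivAt_integral_comp_sub_mul hmom a hφ_le hφ_deriv x using 1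
    rw [hp]
    simp only
    rw [← integral_const_mul, ← integral_const_mul,
      ← integral_add ((hφ_int x).const_mul _) ((hmul_int x).const_mul _)]
    congr 1
    ext y
    ring
  refine ⟨hp_pos, fun x => (hp_deriv x).differentiableAt, fun x => ?_⟩
  have hpx := (hp_pos x).ne'
  rw [(hp_deriv x).deriv, hm]
  beta_reduce
  generalize ∫ y, y * φ (x - a * y) ∂ν = I
  field_simp
  ring
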